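/- Let G : ℝ² \ {0} → ℝ² be defined by G(y) = y^⊥ / |y|³, where y^⊥ = (−y₂, y₁). Then for every multi-index β ∈ ℕ₀² and every y ≠ 0, |∂^β G(y)| ≤ 2^{|β|} · (2|β|+1)!! / |y|^{|β|+2}, where (2|β|+1)!! is the double factorial of 2|β|+1. -/

import Mathlib

/-- Euclidean norm on `ℝ²` (represented as `ℝ × ℝ`). -/
noncomputable def nrm (y : ℝ × ℝ) : ℝ := Real.sqrt (y.1 ^ 2 + y.2 ^ 2)

/-- Partial derivative in the first variable. -/
noncomputable def pd1 (f : ℝ × ℝ → ℝ) : ℝ × ℝ → ℝ :=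
  fun y => deriv (fun s => f (s, y.2)) y.1

/-- Partial derivative in the second variable. -/
noncomputable def pd2 (f : ℝ × ℝ → ℝ) : ℝ × ℝ → ℝ :=
  fun y => deriv (fun s => f (y.1, s)) y.2

/-- The iterated partial derivative `∂^β = ∂_{y_1}^{β₁} ∂_{y_2}^{β₂}`. -/
noncomputable def pdMulti (β₁ β₂ : ℕ) (f : ℝ × ℝ → ℝ) : ℝ × ℝ → ℝ :=
  (pd1)^[β₁] ((pd2)^[β₂] f)

/-- First component of `G(y) = y^⊥/|y|³`, where `y^⊥ = (−y₂, y₁)`. -/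
noncomputable def G1 (y : ℝ × ℝ) : ℝ := -y.2 / nrm y ^ 3

/-- Second component of `G(y) = y^⊥/|y|³`. -/
noncomputable def G2 (y : ℝ × ℝ) : ℝ := y.1 / nrm y ^ 3

open Complex Topology

/-- The kernel `z ^ (b + 1) * conj z ^ a / |z| ^ (2 (a + b) + 3)`, where `z = y₁ + i y₂`. It is, up
to a constant, `∂_z ^ a ∂_{conj z} ^ b` applied to `z / |z| ^ 3`. -/
noncomputable def wirtingerKernel (a b : ℕ) (y : ℝ × ℝ) : ℂ :=
  (⟨y.1, y.2⟩ : ℂ) ^ (b + 1) * (⟨y.1, -y.2⟩ : ℂ) ^ a / (nrm y : ℂ) ^ (2 * (a + b) + 3)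

/-- `IsKernelSum n C f` says that `f` is a linear combination of the kernels `wirtingerKernel a b`
with `a + b = n`, the absolute values of whose coefficients sum to `C`. -/
inductive IsKernelSum : ℕ → ℝ → (ℝ × ℝ → ℂ) → Prop
  | term (c : ℂ) (a b : ℕ) : IsKernelSum (a + b) ‖c‖ (fun y => c * wirtingerKernel a b y)
  | add {n : ℕ} {C D : ℝ} {f g : ℝ × ℝ → ℂ} (hf : IsKernelSum n C f) (hg : IsKernelSum n D g) :
      IsKernelSum n (C + D) (fun y => f y + g y)

theorem sq_add_sq_pos_of_ne_zero {y : ℝ × ℝ} (hy : y ≠ 0) : 0 < y.1 ^ 2 + y.2 ^ 2 := by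
  by_contra! h
  apply hy
  ext <;> simp only [Prod.fst_zero, Prod.snd_zero] <;> nlinarith [sq_nonneg y.1, sq_nonneg y.2]

theorem nrm_pos {y : ℝ × ℝ} (hy : y ≠ 0) : 0 < nrm y :=
  Real.sqrt_pos.2 (sq_add_sq_pos_of_ne_zero hy)

theorem norm_mk_eq_sqrt (u v : ℝ) : ‖(⟨u, v⟩ : ℂ)‖ = √(u ^ 2 + v ^ 2) := by
  rw [Complex.norm_def, Complex.normSq_mk, sq, sq]

theorem norm_wirtingerKernel (a b : ℕ) {y : ℝ × ℝ} (hy : y ≠ 0) :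
    ‖wirtingerKernel a b y‖ = 1 / nrm y ^ (a + b + 2) := by
  have hr := nrm_pos hy
  have h1 : ‖(⟨y.1, y.2⟩ : ℂ)‖ = nrm y := norm_mk_eq_sqrt _ _
  have h2 : ‖(⟨y.1, -y.2⟩ : ℂ)‖ = nrm y := by rw [norm_mk_eq_sqrt, neg_sq]; rfl
  rw [wirtingerKernel, norm_div, norm_mul, norm_pow, norm_pow, norm_pow, h1, h2,
    Complex.norm_of_nonneg hr.le, div_eq_div_iff (by positivity) (by positivity)]
  ring

theorem hasDerivAt_complex_mk {p q : ℝ → ℝ} {u v t : ℝ} (hp : HasDerivAt p u t)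
    (hq : HasDerivAt q v t) : HasDerivAt (fun s => (⟨p s, q s⟩ : ℂ)) ⟨u, v⟩ t := by
  simp only [Complex.mk_eq_add_mul_I]
  exact hp.ofReal_comp.add (hq.ofReal_comp.mul_const I)

theorem hasDerivAt_nrm_comp {p : ℝ → ℝ × ℝ} {u v t : ℝ}
    (hp : HasDerivAt (fun s => (p s).1) u t) (hq : HasDerivAt (fun s => (p s).2) v t)
    (h0 : p t ≠ 0) :
    HasDerivAt (fun s => nrm (p s)) (((p t).1 * u + (p t).2 * v) / nrm (p t)) t := by
  have h := ((hp.pow 2).add (hq.pow 2)).sqrt (sq_add_sq_pos_of_ne_zero h0).ne'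
  have hr := nrm_pos h0
  refine h.congr_deriv ?_
  change _ / (2 * nrm (p t)) = _
  field_simp
  norm_num
  ring

theorem hasDerivAt_wirtingerKernel_comp (a b : ℕ) {p : ℝ → ℝ × ℝ} {u v t : ℝ}
    (hp : HasDerivAt (fun s => (p s).1) u t) (hq : HasDerivAt (fun s => (p s).2) v t)
    (h0 : p t ≠ 0) :
    HasDerivAt (fun s => wirtingerKernel a b (p s))
      (-(⟨u, v⟩ * (a + 1 / 2)) * wirtingerKernel (a + 1) b (p t) +
        -(⟨u, -v⟩ * (b + 3 / 2)) * wirtingerKernel a (b + 1) (p t)) t := by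
  have hr := nrm_pos h0
  have hz := hasDerivAt_complex_mk hp hq
  have hw := hasDerivAt_complex_mk hp hq.neg
  have hn := (hasDerivAt_nrm_comp hp hq h0).ofReal_comp
  have hrC : (nrm (p t) : ℂ) ≠ 0 := by exact_mod_cast hr.ne'
  have h := ((hz.pow (b + 1)).mul (hw.pow a)).div (hn.pow (2 * (a + b) + 3))
    (pow_ne_zero _ hrC)
  refine h.congr_deriv ?_
  have hsq : nrm (p t) ^ 2 = (p t).1 ^ 2 + (p t).2 ^ 2 :=
    Real.sq_sqrt (sq_add_sq_pos_of_ne_zero h0).le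
  have hrr : (nrm (p t) : ℂ) ^ 2 = ⟨(p t).1, (p t).2⟩ * ⟨(p t).1, -(p t).2⟩ := by
    rw [← Complex.ofReal_pow, hsq]
    apply Complex.ext <;> simp [sq]
    ring
  have hin : (((p t).1 * u + (p t).2 * v : ℝ) : ℂ) =
      (⟨u, v⟩ * ⟨(p t).1, -(p t).2⟩ + ⟨u, -v⟩ * ⟨(p t).1, (p t).2⟩) / 2 := by
    rw [eq_div_iff two_ne_zero]
    apply Complex.ext <;> simp <;> ring
  simp only [wirtingerKernel, Pi.pow_apply, Pi.mul_apply, Complex.ofReal_div, hin]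
  have hz0 : (⟨(p t).1, (p t).2⟩ : ℂ) ≠ 0 := fun h => by simp [h, hrC] at hrr
  have hw0 : (⟨(p t).1, -(p t).2⟩ : ℂ) ≠ 0 := fun h => by simp [h, hrC] at hrr
  generalize (⟨(p t).1, (p t).2⟩ : ℂ) = z at *
  generalize (⟨(p t).1, -(p t).2⟩ : ℂ) = w at *
  generalize (⟨u, v⟩ : ℂ) = e at *
  generalize (⟨u, -v⟩ : ℂ) = e' at *
  generalize (nrm (p t) : ℂ) = r at *
  have ha : (a : ℂ) * w ^ (a - 1) = a * w ^ a / w := by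
    rcases a with _ | a
    · simp
    · field_simp
      simp [pow_succ]
  have e1 : r ^ (2 * (a + 1 + b) + 3) = r ^ (2 * (a + b)) * r ^ 5 := by ring
  have e2 : r ^ (2 * (a + (b + 1)) + 3) = r ^ (2 * (a + b)) * r ^ 5 := by ring
  have e3 : r ^ (2 * (a + b) + 3 - 1) = r ^ (2 * (a + b)) * r ^ 2 := pow_add _ _ 2
  have hR : r ^ (2 * (a + b)) ≠ 0 := pow_ne_zero _ hrC
  simp only [Nat.add_sub_cancel, mul_assoc, ha, e1, e2, e3, pow_add r (2 * (a + b)) 3,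
    pow_succ z (b + 1), pow_succ z b, pow_succ w a]
  clear h ha e1 e2 e3
  generalize r ^ (2 * (a + b)) = R at *
  generalize z ^ b = Z at *
  generalize w ^ a = W at *
  push_cast
  field_simp
  linear_combination 2 * Z * W * ((b + 1) * e * w + z * a * e') * hrr

theorem IsKernelSum.norm_le {n : ℕ} {C : ℝ} {f : ℝ × ℝ → ℂ} (hf : IsKernelSum n C f)
    {y : ℝ × ℝ} (hy : y ≠ 0) : ‖f y‖ ≤ C / nrm y ^ (n + 2) := by
  induction hf with
  | term c a b => rw [norm_mul, norm_wirtingerKernel a b hy, mul_one_div]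
  | add _ _ hf hg => exact (norm_add_le _ _).trans ((add_le_add hf hg).trans_eq (add_div ..).symm)

theorem IsKernelSum.exists_hasDerivAt {n : ℕ} {C : ℝ} {f : ℝ × ℝ → ℂ} (hf : IsKernelSum n C f)
    {u v : ℝ} (huv : u ^ 2 + v ^ 2 = 1) :
    ∃ g, IsKernelSum (n + 1) ((n + 2) * C) g ∧ ∀ (p : ℝ → ℝ × ℝ) (t : ℝ),
      HasDerivAt (fun s => (p s).1) u t → HasDerivAt (fun s => (p s).2) v t → p t ≠ 0 →
      HasDerivAt (fun s => f (p s)) (g (p t)) t := by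
  induction hf with
  | term c a b =>
    have h1 := IsKernelSum.term (c * -(⟨u, v⟩ * (a + 1 / 2))) (a + 1) b
    have h2 := IsKernelSum.term (c * -(⟨u, -v⟩ * (b + 3 / 2))) a (b + 1)
    rw [add_right_comm] at h1
    have hC : ‖c * -(⟨u, v⟩ * (a + 1 / 2))‖ + ‖c * -(⟨u, -v⟩ * (b + 3 / 2))‖ =
        (((a + b : ℕ) : ℝ) + 2) * ‖c‖ := by
      have ha : ‖(a + 1 / 2 : ℂ)‖ = a + 1 / 2 := by
        rw [← Complex.norm_of_nonneg (by positivity : (0 : ℝ) ≤ a + 1 / 2)]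
        push_cast
        rfl
      have hb : ‖(b + 3 / 2 : ℂ)‖ = b + 3 / 2 := by
        rw [← Complex.norm_of_nonneg (by positivity : (0 : ℝ) ≤ b + 3 / 2)]
        push_cast
        rfl
      simp only [norm_mul, norm_neg, norm_mk_eq_sqrt, neg_sq, huv, Real.sqrt_one, ha, hb]
      push_cast
      ring
    refine ⟨_, hC ▸ h1.add h2, fun p t hp hq h0 =>
      ((hasDerivAt_wirtingerKernel_comp a b hp hq h0).const_mul c).congr_deriv ?_⟩
    ring
  | @add n C D _ _ _ _ hf hg =>
    obtain ⟨f', hf', hdf⟩ := hf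
    obtain ⟨g', hg', hdg⟩ := hg
    refine ⟨_, mul_add _ C D ▸ hf'.add hg', fun p t hp hq h0 =>
      (hdf p t hp hq h0).fun_add (hdg p t hp hq h0)⟩

/-- Away from the origin, `f₁` and `f₂` are the real and imaginary parts of a linear combination of
kernels `wirtingerKernel a b`, `a + b = n`, with total coefficient mass `(n + 1)!`. -/
def IsKernelPair (n : ℕ) (f₁ f₂ : ℝ × ℝ → ℝ) : Prop :=
  ∃ g, IsKernelSum n (n + 1).factorial g ∧ ∀ y ≠ 0, f₁ y = (g y).re ∧ f₂ y = (g y).im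

theorem isKernelPair_G : IsKernelPair 0 G1 G2 := by
  refine ⟨_, by simpa using IsKernelSum.term I 0 0, fun y hy => ?_⟩
  have h : I * wirtingerKernel 0 0 y = ⟨G1 y, G2 y⟩ := by
    have hr : (nrm y : ℂ) ≠ 0 := by exact_mod_cast (nrm_pos hy).ne'
    rw [Complex.mk_eq_add_mul_I]
    simp only [wirtingerKernel, G1, G2, Complex.mk_eq_add_mul_I]
    push_cast
    field_simp
    ring_nf
    simp
    ring
  simp [h]

theorem IsKernelPair.hasDerivAt {n : ℕ} {f₁ f₂ : ℝ × ℝ → ℝ} (hf : IsKernelPair n f₁ f₂)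
    {u v : ℝ} (huv : u ^ 2 + v ^ 2 = 1) :
    ∃ g, IsKernelSum (n + 1) (n + 1 + 1).factorial g ∧ ∀ (p : ℝ → ℝ × ℝ) (t : ℝ),
      HasDerivAt (fun s => (p s).1) u t → HasDerivAt (fun s => (p s).2) v t → p t ≠ 0 →
      HasDerivAt (fun s => f₁ (p s)) (g (p t)).re t ∧
        HasDerivAt (fun s => f₂ (p s)) (g (p t)).im t := by
  obtain ⟨f, hf, heq⟩ := hf
  obtain ⟨g, hg, hd⟩ := hf.exists_hasDerivAt huv
  refine ⟨g, ?_, fun p t hp hq h0 => ?_⟩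
  · convert hg using 1
    rw [Nat.factorial_succ (n + 1)]
    push_cast
    ring
  · have hev : ∀ᶠ s in 𝓝 t, p s ≠ 0 :=
      (hp.continuousAt.prodMk hq.continuousAt).eventually_ne h0
    have h := hd p t hp hq h0
    have hre := (Complex.reCLM.hasFDerivAt.comp_hasDerivAt t h)
    have him := (Complex.imCLM.hasFDerivAt.comp_hasDerivAt t h)
    exact ⟨hre.congr_of_eventuallyEq (hev.mono fun s hs => (heq _ hs).1),
      him.congr_of_eventuallyEq (hev.mono fun s hs => (heq _ hs).2)⟩

theorem IsKernelPair.pd1 {n : ℕ} {f₁ f₂ : ℝ × ℝ → ℝ} (hf : IsKernelPair n f₁ f₂) :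
    IsKernelPair (n + 1) (pd1 f₁) (pd1 f₂) := by
  obtain ⟨g, hg, hd⟩ := hf.hasDerivAt (u := 1) (v := 0) (by norm_num)
  refine ⟨g, hg, fun y hy => ?_⟩
  have h := hd (fun s => (s, y.2)) y.1 (hasDerivAt_id _) (hasDerivAt_const _ _) hy
  exact ⟨h.1.deriv, h.2.deriv⟩

theorem IsKernelPair.pd2 {n : ℕ} {f₁ f₂ : ℝ × ℝ → ℝ} (hf : IsKernelPair n f₁ f₂) :
    IsKernelPair (n + 1) (pd2 f₁) (pd2 f₂) := by
  obtain ⟨g, hg, hd⟩ := hf.hasDerivAt (u := 0) (v := 1) (by norm_num)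
  refine ⟨g, hg, fun y hy => ?_⟩
  have h := hd (fun s => (y.1, s)) y.2 (hasDerivAt_const _ _) (hasDerivAt_id _) hy
  exact ⟨h.1.deriv, h.2.deriv⟩

theorem isKernelPair_pdMulti (β₁ β₂ : ℕ) :
    IsKernelPair (β₁ + β₂) (pdMulti β₁ β₂ G1) (pdMulti β₁ β₂ G2) := by
  induction β₁ with
  | zero =>
    induction β₂ with
    | zero => exact isKernelPair_G
    | succ k ih =>
      simp only [pdMulti, Function.iterate_succ_apply', Function.iterate_zero, id_eq,
        ← add_assoc] at ih ⊢
      exact ih.pd2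
  | succ k ih =>
    simp only [pdMulti, Function.iterate_succ_apply', add_right_comm k 1] at ih ⊢
    exact ih.pd1

theorem factorial_succ_le_two_pow_mul_doubleFactorial (n : ℕ) :
    (n + 1).factorial ≤ 2 ^ n * (2 * n + 1).doubleFactorial := by
  induction n with
  | zero => simp
  | succ k ih =>
    rw [Nat.factorial_succ, show 2 * (k + 1) + 1 = 2 * k + 1 + 2 by ring,
      Nat.doubleFactorial_add_two, pow_succ]
    calc (k + 1 + 1) * (k + 1).factorial
        ≤ (2 * (2 * k + 1 + 2)) * (2 ^ k * (2 * k + 1).doubleFactorial) :=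
          Nat.mul_le_mul (by lia) ih
      _ = _ := by ring

/-- Derivative bounds `|∂^β (y^⊥/|y|³)| ≤ 2^{|β|}(2|β|+1)!!/|y|^{|β|+2}`. -/
theorem riesz_kernel_derivative_bounds (β₁ β₂ : ℕ) (y : ℝ × ℝ) (hy : y ≠ 0) :
    Real.sqrt ((pdMulti β₁ β₂ G1 y) ^ 2 + (pdMulti β₁ β₂ G2 y) ^ 2) ≤
      2 ^ (β₁ + β₂) * ((2 * (β₁ + β₂) + 1).doubleFactorial : ℝ) / nrm y ^ (β₁ + β₂ + 2) := by
  obtain ⟨g, hg, heq⟩ := isKernelPair_pdMulti β₁ β₂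
  have hr := nrm_pos hy
  rw [(heq y hy).1, (heq y hy).2, ← norm_mk_eq_sqrt]
  refine (hg.norm_le hy).trans ?_
  gcongr
  exact_mod_cast factorial_succ_le_two_pow_mul_doubleFactorial (β₁ + β₂)
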